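/- Let w ∈ Ŵ be minuscule with I_w ≠ ∅, and let γ ∈ Δ⁺ \ I_w be such that w(δ − γ) = β ∈ Π̂ (so that s_β·w is minuscule with I_{s_β w} = I_w ∪ {γ}). Then τ(I_{s_β w}) = s_β(τ(I_w)) and τ(I_{s_β w}) ≼ τ(I_w); moreover, if β = α₀, then τ(I_{s_β w}) = τ(I_w). -/

import Mathlib

open scoped BigOperators

/-- Data of a reduced irreducible crystallographic root system `Δ`, spanning a
`ℚ`-vector space `V` equipped with a Weyl-group-invariant inner product `B`,
together with a chosen system of positive roots `Pos` and the highest root `θ`. -/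
structure RootSystemCtx (V : Type*) [AddCommGroup V] [Module ℚ V] where
  /-- the invariant inner product `( , )` -/
  B : V →ₗ[ℚ] V →ₗ[ℚ] ℚ
  B_symm : ∀ x y : V, B x y = B y x
  B_posdef : ∀ x : V, x ≠ 0 → 0 < B x x
  /-- the set of roots -/
  Δ : Set V
  Δ_finite : Δ.Finite
  Δ_spans : Submodule.span ℚ Δ = ⊤
  zero_notMem_Δ : (0 : V) ∉ Δ
  neg_mem_Δ : ∀ α ∈ Δ, -α ∈ Δ
  reduced : ∀ α ∈ Δ, ∀ c : ℚ, c • α ∈ Δ → c = 1 ∨ c = -1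
  crystallographic : ∀ α ∈ Δ, ∀ β ∈ Δ, ∃ n : ℤ, 2 * B α β / B β β = (n : ℚ)
  reflect_mem : ∀ α ∈ Δ, ∀ β ∈ Δ, β - (2 * B β α / B α α) • α ∈ Δ
  irreducible : ∀ S : Set V, S ⊆ Δ → (∀ α ∈ S, ∀ β ∈ Δ \ S, B α β = 0) → S = ∅ ∨ S = Δ
  /-- the positive roots `Δ⁺` -/
  Pos : Set V
  pos_subset : Pos ⊆ Δ
  mem_pos_or_neg_pos : ∀ α ∈ Δ, α ∈ Pos ∨ -α ∈ Pos
  pos_not_neg : ∀ α ∈ Pos, -α ∉ Pos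
  add_pos_mem : ∀ α ∈ Pos, ∀ β ∈ Pos, α + β ∈ Δ → α + β ∈ Pos
  /-- the highest root `θ` -/
  θ : V
  θ_pos : θ ∈ Pos
  θ_highest : ∀ ν ∈ Δ, θ - ν ∈ AddSubmonoid.closure Pos

namespace RootSystemCtx

variable {V : Type*} [AddCommGroup V] [Module ℚ V] (ctx : RootSystemCtx V)

/-- the simple roots `Π`: indecomposable positive roots -/
def simple : Set V :=
  {α | α ∈ ctx.Pos ∧ ¬∃ β ∈ ctx.Pos, ∃ γ ∈ ctx.Pos, α = β + γ}

/-- `ρ`, the half-sum of all positive roots -/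
noncomputable def ρ : V :=
  (1 / 2 : ℚ) • ∑ α ∈ (ctx.Δ_finite.subset ctx.pos_subset).toFinset, α

/-- the coroot `μ∨ = 2μ/(μ,μ)` -/
noncomputable def coroot (μ : V) : V := (2 / ctx.B μ μ) • μ

/-- `Δ⁺_l`, the long positive roots (roots of the same length as `θ`) -/
def PosLong : Set V := {μ | μ ∈ ctx.Pos ∧ ctx.B μ μ = ctx.B ctx.θ ctx.θ}

/-- `Π_l`, the long simple roots -/
def SimpleLong : Set V := {μ | μ ∈ ctx.simple ∧ ctx.B μ μ = ctx.B ctx.θ ctx.θ}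

/-- the dominance order `μ ≼ ν` on the root lattice: `ν - μ` is a nonnegative
integer combination of positive roots -/
def le (μ ν : V) : Prop := ν - μ ∈ AddSubmonoid.closure ctx.Pos

/-- a (combinatorial) abelian ideal of `Δ⁺` -/
def IsAbelianIdeal (I : Set V) : Prop :=
  I ⊆ ctx.Pos ∧ (∀ μ ∈ I, ∀ ν ∈ I, μ + ν ∉ ctx.Δ) ∧
    ∀ γ ∈ I, ∀ ν ∈ ctx.Pos, γ + ν ∈ ctx.Δ → γ + ν ∈ I

/-- `γ` is a generator of the ideal `I` -/
def IsGenerator (I : Set V) (γ : V) : Prop := γ ∈ I ∧ ∀ α ∈ ctx.Pos, γ - α ∉ I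

/-! ### The affine picture: `V̂ = V ⊕ ℚδ ⊕ ℚλ`, modelled as `V × ℚ × ℚ`,
with `δ = (0,1,0)` and `λ = (0,0,1)`. -/

/-- the embedding of `V` into `V̂` -/
def emb (_ctx : RootSystemCtx V) (v : V) : V × ℚ × ℚ := (v, 0, 0)

/-- the imaginary root `δ` -/
def δhat (_ctx : RootSystemCtx V) : V × ℚ × ℚ := (0, 1, 0)

/-- the affine simple root `α₀ = δ - θ` -/
def alpha0 : V × ℚ × ℚ := (-ctx.θ, 1, 0)

/-- the extension of the inner product to `V̂`, with
`(δ,V)=(λ,V)=(δ,δ)=(λ,λ)=0` and `(δ,λ)=1` -/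
noncomputable def Bhat : (V × ℚ × ℚ) →ₗ[ℚ] (V × ℚ × ℚ) →ₗ[ℚ] ℚ :=
  LinearMap.mk₂ ℚ (fun x y => ctx.B x.1 y.1 + x.2.1 * y.2.2 + x.2.2 * y.2.1)
    (fun x x' y => by
      simp only [Prod.fst_add, Prod.snd_add, map_add, LinearMap.add_apply]; ring)
    (fun c x y => by
      simp only [Prod.smul_fst, Prod.smul_snd, map_smul, LinearMap.smul_apply,
        smul_eq_mul]; ring)
    (fun x y y' => by
      simp only [Prod.fst_add, Prod.snd_add, map_add]; ring)
    (fun c x y => by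
      simp only [Prod.smul_fst, Prod.smul_snd, map_smul, smul_eq_mul]; ring)

/-- the set `Δ̂` of affine real roots -/
def Δhat : Set (V × ℚ × ℚ) := {x | ∃ α ∈ ctx.Δ, ∃ k : ℤ, x = (α, (k : ℚ), 0)}

/-- the set `Δ̂⁺` of positive affine roots -/
def PosHat : Set (V × ℚ × ℚ) :=
  {x | ∃ α ∈ ctx.Pos, x = (α, 0, 0)} ∪
    {x | ∃ α ∈ ctx.Δ, ∃ k : ℤ, 1 ≤ k ∧ x = (α, (k : ℚ), 0)}

/-- the set `Π̂ = Π ∪ {α₀}` of affine simple roots -/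
def SimpleHat : Set (V × ℚ × ℚ) :=
  {x | ∃ α ∈ ctx.simple, x = (α, (0 : ℚ), (0 : ℚ))} ∪ {ctx.alpha0}

/-- the reflection `s_β : x ↦ x − (2(x,β)/(β,β))·β` in `V̂` -/
noncomputable def refl (β : V × ℚ × ℚ) : (V × ℚ × ℚ) ≃ₗ[ℚ] (V × ℚ × ℚ) :=
  if h : ctx.Bhat β β = 0 then LinearEquiv.refl ℚ _
  else
    Module.reflection (x := β) (f := (2 / ctx.Bhat β β) • ctx.Bhat β)
      (by simp only [LinearMap.smul_apply, smul_eq_mul]; field_simp)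

/-- the affine Weyl group `Ŵ`, generated by the reflections `s_β`, `β ∈ Δ̂` -/
def What : Subgroup ((V × ℚ × ℚ) ≃ₗ[ℚ] (V × ℚ × ℚ)) :=
  Subgroup.closure {g | ∃ β ∈ ctx.Δhat, g = ctx.refl β}

/-- the finite Weyl group `W`, generated by the reflections `s_α`, `α ∈ Δ`
(identified with a subgroup of `Ŵ`) -/
def Wfin : Subgroup ((V × ℚ × ℚ) ≃ₗ[ℚ] (V × ℚ × ℚ)) :=
  Subgroup.closure {g | ∃ α ∈ ctx.Δ, g = ctx.refl (α, (0 : ℚ), (0 : ℚ))}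

/-- `N̂(w) = {β ∈ Δ̂⁺ : w(β) ∈ −Δ̂⁺}` -/
def Nhat (w : (V × ℚ × ℚ) ≃ₗ[ℚ] (V × ℚ × ℚ)) : Set (V × ℚ × ℚ) :=
  {β | β ∈ ctx.PosHat ∧ -(w β) ∈ ctx.PosHat}

/-- a minuscule element of `Ŵ`: every element of `N̂(w)` has the form `δ - γ`
with `γ ∈ Δ⁺` -/
def IsMinuscule (w : (V × ℚ × ℚ) ≃ₗ[ℚ] (V × ℚ × ℚ)) : Prop :=
  w ∈ ctx.What ∧ ∀ β ∈ ctx.Nhat w, ∃ γ ∈ ctx.Pos, β = ctx.δhat - ctx.emb γ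

/-- the abelian ideal `I_w` corresponding to a minuscule element `w` -/
def idealOf (w : (V × ℚ × ℚ) ≃ₗ[ℚ] (V × ℚ × ℚ)) : Set V :=
  {γ | γ ∈ ctx.Pos ∧ ctx.δhat - ctx.emb γ ∈ ctx.Nhat w}

/-- the ideal `I` has rootlet `τ(I) = μ`, i.e. `I = I_w` for some minuscule `w`
with `w(α₀) + δ = μ` -/
def HasRootlet (I : Set V) (μ : V) : Prop :=
  ∃ w, ctx.IsMinuscule w ∧ ctx.idealOf w = I ∧ w ctx.alpha0 + ctx.δhat = ctx.emb μ

/-- `Ab_μ`, the set of nonempty abelian ideals with rootlet `μ` -/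
def AbFiber (μ : V) : Set (Set V) := {I | I.Nonempty ∧ ctx.HasRootlet I μ}

/-- `N(u) = {γ ∈ Δ⁺ : u(γ) ∈ −Δ⁺}` for `u` in the finite Weyl group -/
def Nfin (w : (V × ℚ × ℚ) ≃ₗ[ℚ] (V × ℚ × ℚ)) : Set V :=
  {γ | γ ∈ ctx.Pos ∧ -(w (ctx.emb γ)) ∈ ctx.PosHat}

/-- the length `l(u) = #N(u)` of an element of the finite Weyl group -/
noncomputable def lenFin (w : (V × ℚ × ℚ) ≃ₗ[ℚ] (V × ℚ × ℚ)) : ℕ :=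
  (ctx.Nfin w).ncard

end RootSystemCtx

namespace RootSystemCtx

variable {V : Type*} [AddCommGroup V] [Module ℚ V] (ctx : RootSystemCtx V)

lemma Bhat_apply (x y : V × ℚ × ℚ) :
    ctx.Bhat x y = ctx.B x.1 y.1 + x.2.1 * y.2.2 + x.2.2 * y.2.1 := rfl

lemma Bhat_symm (x y : V × ℚ × ℚ) : ctx.Bhat x y = ctx.Bhat y x := by
  rw [Bhat_apply, Bhat_apply, ctx.B_symm]
  ring

lemma B_self_pos {α : V} (hα : α ∈ ctx.Δ) : 0 < ctx.B α α :=
  ctx.B_posdef α fun h => ctx.zero_notMem_Δ (h ▸ hα)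

lemma refl_apply (β x : V × ℚ × ℚ) :
    ctx.refl β x = x - (2 * ctx.Bhat x β / ctx.Bhat β β) • β := by
  unfold refl
  split_ifs with h
  · simp [h]
  · rw [Module.reflection_apply, ctx.Bhat_symm x β]
    simp only [LinearMap.smul_apply, smul_eq_mul]
    congr 2
    ring

lemma Bhat_refl_refl (β x y : V × ℚ × ℚ) :
    ctx.Bhat (ctx.refl β x) (ctx.refl β y) = ctx.Bhat x y := by
  rw [refl_apply, refl_apply]
  simp only [map_sub, map_smul, LinearMap.sub_apply, LinearMap.smul_apply, smul_eq_mul]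
  rw [ctx.Bhat_symm β y]
  by_cases h : ctx.Bhat β β = 0
  · simp [h]
  · field_simp
    ring

lemma refl_refl (β x : V × ℚ × ℚ) : ctx.refl β (ctx.refl β x) = x := by
  by_cases h : ctx.Bhat β β = 0
  · simp [refl_apply, h]
  · rw [ctx.refl_apply β (ctx.refl β x), refl_apply, sub_sub, ← add_smul]
    simp only [map_sub, map_smul, LinearMap.sub_apply, LinearMap.smul_apply, smul_eq_mul]
    convert sub_zero x
    convert zero_smul ℚ β
    field_simp
    ring

lemma refl_δhat {β : V × ℚ × ℚ} (hβ : β.2.2 = 0) : ctx.refl β ctx.δhat = ctx.δhat := by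
  simp [refl_apply, Bhat_apply, δhat, hβ]

lemma refl_mem_Δhat {β x : V × ℚ × ℚ} (hβ : β ∈ ctx.Δhat) (hx : x ∈ ctx.Δhat) :
    ctx.refl β x ∈ ctx.Δhat := by
  obtain ⟨α, hα, k, rfl⟩ := hβ
  obtain ⟨α', hα', m, rfl⟩ := hx
  obtain ⟨n, hn⟩ := ctx.crystallographic α' hα' α hα
  refine ⟨_, ctx.reflect_mem α hα α' hα', m - n * k, ?_⟩
  simp [refl_apply, Bhat_apply, hn]

lemma What_apply_δhat {w : (V × ℚ × ℚ) ≃ₗ[ℚ] (V × ℚ × ℚ)} (hw : w ∈ ctx.What) :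
    w ctx.δhat = ctx.δhat := by
  induction hw using Subgroup.closure_induction with
  | mem g hg =>
    obtain ⟨β, ⟨α, _, k, rfl⟩, rfl⟩ := hg
    exact ctx.refl_δhat rfl
  | one => rfl
  | mul g h _ _ hg hh => rw [LinearEquiv.mul_apply, hh, hg]
  | inv g _ hg => exact (LinearEquiv.symm_apply_eq g).2 hg.symm

lemma Bhat_What {w : (V × ℚ × ℚ) ≃ₗ[ℚ] (V × ℚ × ℚ)} (hw : w ∈ ctx.What)
    (x y : V × ℚ × ℚ) : ctx.Bhat (w x) (w y) = ctx.Bhat x y := by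
  induction hw using Subgroup.closure_induction generalizing x y with
  | mem g hg =>
    obtain ⟨β, _, rfl⟩ := hg
    exact ctx.Bhat_refl_refl β x y
  | one => rfl
  | mul g h _ _ hg hh => rw [LinearEquiv.mul_apply, LinearEquiv.mul_apply, hg, hh]
  | inv g _ hg =>
    rw [← hg]
    exact congrArg₂ (fun a b => ctx.Bhat a b) (g.apply_symm_apply x) (g.apply_symm_apply y)

lemma What_apply_mem_Δhat_iff {w : (V × ℚ × ℚ) ≃ₗ[ℚ] (V × ℚ × ℚ)} (hw : w ∈ ctx.What)
    (x : V × ℚ × ℚ) : w x ∈ ctx.Δhat ↔ x ∈ ctx.Δhat := by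
  induction hw using Subgroup.closure_induction generalizing x with
  | mem g hg =>
    obtain ⟨β, hβ, rfl⟩ := hg
    refine ⟨fun h => ?_, ctx.refl_mem_Δhat hβ⟩
    simpa only [refl_refl] using ctx.refl_mem_Δhat hβ h
  | one => rfl
  | mul g h _ _ hg hh => rw [LinearEquiv.mul_apply, hg, hh]
  | inv g _ hg =>
    rw [← hg]
    exact iff_of_eq (congrArg (· ∈ ctx.Δhat) (g.apply_symm_apply x))

/-- Two roots at an obtuse angle have a root as their sum, unless they are opposite. -/
lemma add_mem_Δ_of_B_neg {α β : V} (hα : α ∈ ctx.Δ) (hβ : β ∈ ctx.Δ)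
    (hneg : ctx.B α β < 0) (hne : α + β ≠ 0) : α + β ∈ ctx.Δ := by
  have hαα := ctx.B_self_pos hα
  have hββ := ctx.B_self_pos hβ
  obtain ⟨p, hp⟩ := ctx.crystallographic α hα β hβ
  obtain ⟨q, hq⟩ := ctx.crystallographic β hβ α hα
  have hp' := (div_eq_iff hββ.ne').1 hp
  have hq' := (div_eq_iff hαα.ne').1 hq
  rw [ctx.B_symm β α] at hq'
  have hp0 : p < 0 := by
    have : (p : ℚ) < 0 := by rw [← hp]; exact div_neg_of_neg_of_pos (by linarith) hββ
    exact_mod_cast this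
  have hq0 : q < 0 := by
    have : (q : ℚ) < 0 := by
      rw [← hq, ctx.B_symm]; exact div_neg_of_neg_of_pos (by linarith) hαα
    exact_mod_cast this
  by_cases hp1 : p = -1
  · simpa [hp, hp1] using ctx.reflect_mem β hβ α hα
  by_cases hq1 : q = -1
  · simpa [hq, hq1, add_comm] using ctx.reflect_mem α hα β hβ
  have hp2 : (p : ℚ) ≤ -2 := by exact_mod_cast (by omega : p ≤ -2)
  have hq2 : (q : ℚ) ≤ -2 := by exact_mod_cast (by omega : q ≤ -2)
  have hsum := ctx.B_posdef _ hne
  simp only [map_add, LinearMap.add_apply, ctx.B_symm β α] at hsum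
  nlinarith

/-- A nonempty sum of positive roots does not vanish. -/
lemma sum_pos_ne_zero (s : Multiset V) (hs : ∀ x ∈ s, x ∈ ctx.Pos) (h0 : s ≠ 0) :
    s.sum ≠ 0 := by
  induction hn : s.card using Nat.strong_induction_on generalizing s with
  | _ n ih =>
    intro hsum
    obtain ⟨a, ha⟩ := Multiset.exists_mem_of_ne_zero h0
    obtain ⟨t, rfl⟩ := Multiset.exists_cons_of_mem ha
    have haΔ := ctx.pos_subset (hs a ha)
    rw [Multiset.sum_cons] at hsum
    obtain ⟨b, hb, hab⟩ : ∃ b ∈ t, ctx.B a b < 0 := by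
      by_contra! h
      have hnonneg : 0 ≤ (t.map (ctx.B a)).sum :=
        Multiset.sum_nonneg fun x hx => by
          obtain ⟨b, hb, rfl⟩ := Multiset.mem_map.1 hx
          exact h b hb
      rw [← map_multiset_sum, eq_neg_of_add_eq_zero_right hsum, map_neg] at hnonneg
      linarith [ctx.B_self_pos haΔ]
    obtain ⟨u, rfl⟩ := Multiset.exists_cons_of_mem hb
    have hbPos : b ∈ ctx.Pos := hs b (by simp)
    have hne : a + b ≠ 0 := fun h =>
      ctx.pos_not_neg b hbPos (eq_neg_of_add_eq_zero_left h ▸ hs a ha)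
    have habPos := ctx.add_pos_mem a (hs a ha) b hbPos
      (ctx.add_mem_Δ_of_B_neg haΔ (ctx.pos_subset hbPos) hab hne)
    refine ih _ ?_ ((a + b) ::ₘ u) ?_ Multiset.cons_ne_zero rfl ?_
    · simp [← hn]
    · intro x hx
      rcases Multiset.mem_cons.1 hx with rfl | hx
      · exact habPos
      · exact hs x (by simp [hx])
    · rw [Multiset.sum_cons, add_assoc, ← Multiset.sum_cons, hsum]

/-- The highest root is dominant. -/
lemma B_θ_nonneg {α : V} (hα : α ∈ ctx.Pos) : 0 ≤ ctx.B ctx.θ α := by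
  by_contra! h
  have hne : ctx.θ + α ≠ 0 := fun h0 =>
    ctx.pos_not_neg α hα (eq_neg_of_add_eq_zero_left h0 ▸ ctx.θ_pos)
  have hmem := ctx.θ_highest _ (ctx.add_mem_Δ_of_B_neg (ctx.pos_subset ctx.θ_pos)
    (ctx.pos_subset hα) h hne)
  obtain ⟨s, hs, hsum⟩ := AddSubmonoid.exists_multiset_of_mem_closure hmem
  refine ctx.sum_pos_ne_zero (α ::ₘ s) ?_ Multiset.cons_ne_zero ?_
  · intro x hx
    rcases Multiset.mem_cons.1 hx with rfl | hx
    · exact hα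
    · exact hs x hx
  · rw [Multiset.sum_cons, hsum]
    abel

/-- The rootlet of a minuscule element is a positive root. -/
lemma IsMinuscule.rootlet_mem_Pos {w : (V × ℚ × ℚ) ≃ₗ[ℚ] (V × ℚ × ℚ)}
    (hw : ctx.IsMinuscule w) {μ : V} (hμ : w ctx.alpha0 + ctx.δhat = ctx.emb μ) :
    μ ∈ ctx.Pos := by
  have hθ := ctx.neg_mem_Δ _ (ctx.pos_subset ctx.θ_pos)
  have hx : w (-ctx.θ, 2, 0) = (μ, 0, 0) := by
    change _ = ctx.emb μ
    rw [← hμ, ← ctx.What_apply_δhat hw.1, ← map_add]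
    congr 1
    simp [alpha0, δhat]
    norm_num
  have hμΔ : μ ∈ ctx.Δ := by
    obtain ⟨α, hα, k, h⟩ := (ctx.What_apply_mem_Δhat_iff hw.1 (-ctx.θ, 2, 0)).2
      ⟨_, hθ, 2, by simp⟩
    rw [hx] at h
    obtain rfl : μ = α := congrArg Prod.fst h
    exact hα
  refine (ctx.mem_pos_or_neg_pos μ hμΔ).resolve_right fun hneg => ?_
  obtain ⟨γ, _, h⟩ := hw.2 (-ctx.θ, 2, 0)
    ⟨Or.inr ⟨_, hθ, 2, by norm_num, by simp⟩, Or.inl ⟨-μ, hneg, by simp [hx]⟩⟩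
  simp [δhat, emb] at h

end RootSystemCtx

/-- Proposition `elem-ext`: under an elementary extension
`w ↦ s_β·w` (with `w(δ − γ) = β ∈ Π̂`), the rootlet transforms by `s_β` and can
only decrease in the dominance order; it is unchanged when `β = α₀`. -/
theorem statement_8 {V : Type*} [AddCommGroup V] [Module ℚ V] (ctx : RootSystemCtx V)
    (w : (V × ℚ × ℚ) ≃ₗ[ℚ] (V × ℚ × ℚ)) (hw : ctx.IsMinuscule w)
    (hne : (ctx.idealOf w).Nonempty)
    (γ : V) (hγpos : γ ∈ ctx.Pos) (hγ : γ ∉ ctx.idealOf w)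
    (β : V × ℚ × ℚ) (hβ : β ∈ ctx.SimpleHat) (hwγ : w (ctx.δhat - ctx.emb γ) = β)
    (μ : V) (hμ : w ctx.alpha0 + ctx.δhat = ctx.emb μ) :
    ∃ ν : V, ctx.emb ν = ctx.refl β (ctx.emb μ) ∧
      (ctx.refl β * w) ctx.alpha0 + ctx.δhat = ctx.emb ν ∧
      ctx.le ν μ ∧ (β = ctx.alpha0 → ν = μ) := by
  have hδ := ctx.What_apply_δhat hw.1
  have hβ2 : β.2.2 = 0 := by
    rcases hβ with ⟨α, _, rfl⟩ | rfl <;> rfl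
  have hpair : ctx.Bhat (ctx.emb μ) β = ctx.B ctx.θ γ := by
    have h := ctx.Bhat_What hw.1 (ctx.alpha0 + ctx.δhat) (ctx.δhat - ctx.emb γ)
    rw [map_add, hδ, hμ, hwγ] at h
    rw [h]
    simp [RootSystemCtx.Bhat_apply, RootSystemCtx.alpha0, RootSystemCtx.δhat,
      RootSystemCtx.emb]
  have hnorm : ctx.Bhat β β = ctx.B γ γ := by
    rw [← hwγ, ctx.Bhat_What hw.1]
    simp [RootSystemCtx.Bhat_apply, RootSystemCtx.δhat, RootSystemCtx.emb]
  have hact : (ctx.refl β * w) ctx.alpha0 + ctx.δhat = ctx.refl β (ctx.emb μ) := by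
    rw [LinearEquiv.mul_apply, ← hμ, map_add, ctx.refl_δhat hβ2]
  have hθγ := ctx.B_θ_nonneg hγpos
  have hrefl := ctx.refl_apply β (ctx.emb μ)
  rw [hpair, hnorm] at hrefl
  rw [hact]
  by_cases hβ0 : β = ctx.alpha0
  · have hθμ := ctx.B_θ_nonneg (RootSystemCtx.IsMinuscule.rootlet_mem_Pos ctx hw hμ)
    have hzero : ctx.B ctx.θ γ = 0 := by
      have h : ctx.B ctx.θ γ = -ctx.B ctx.θ μ := by
        rw [← hpair, hβ0, ctx.B_symm ctx.θ μ]
        simp [RootSystemCtx.Bhat_apply, RootSystemCtx.alpha0, RootSystemCtx.emb]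
      linarith
    have hfix : ctx.refl β (ctx.emb μ) = ctx.emb μ := by
      rw [hrefl, hzero]
      simp
    refine ⟨μ, hfix.symm, hfix, ?_, fun _ => rfl⟩
    rw [RootSystemCtx.le, sub_self]
    exact zero_mem _
  · obtain ⟨α, hα, rfl⟩ := hβ.resolve_right hβ0
    obtain ⟨n, hn⟩ := ctx.crystallographic _ (ctx.pos_subset ctx.θ_pos) γ
      (ctx.pos_subset hγpos)
    have hn0 : 0 ≤ n := by
      have : (0 : ℚ) ≤ n := by
        rw [← hn]
        exact div_nonneg (by linarith) (ctx.B_self_pos (ctx.pos_subset hγpos)).le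
      exact_mod_cast this
    lift n to ℕ using hn0
    have hν : ctx.refl (α, 0, 0) (ctx.emb μ) = ctx.emb (μ - n • α) := by
      rw [hrefl, hn]
      simp [RootSystemCtx.emb, Nat.cast_smul_eq_nsmul, Prod.ext_iff]
    refine ⟨μ - n • α, hν.symm, hν, ?_, fun h => absurd h hβ0⟩
    rw [RootSystemCtx.le, sub_sub_cancel]
    exact nsmul_mem (AddSubmonoid.subset_closure hα.1) n
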